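/- arXiv:2305.12486 — 3 statements merged into one kernel-verified Lean document; each statement's English description precedes it below -/
import Mathlib

section
/- If (T_s)_{s∈2^{<ω}} is a splitting system, then T = ⋂_n ⋃_{s∈2^n} T_s is a perfect tree, T ⊆ T_Λ, and [T] = ⋂_n ⋃_{s∈2^n} [T_s]. -/
open Set

/-- A tree on binary strings: a set of finite binary strings closed under initial segments. -/
def IsTree (T : Set (List Bool)) : Prop :=
  ∀ ⦃s t : List Bool⦄, s <+: t → t ∈ T → s ∈ T

/-- The restriction `T↾s = {t ∈ T : s ⊆ t ∨ t ⊆ s}`. -/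
def restr (T : Set (List Bool)) (s : List Bool) : Set (List Bool) :=
  {t ∈ T | s <+: t ∨ t <+: s}

/-- A perfect tree: a nonempty tree with no endpoints and no isolated branches, i.e.
every node extends to a branching node. -/
def IsPerfect (T : Set (List Bool)) : Prop :=
  IsTree T ∧ T.Nonempty ∧
    ∀ s ∈ T, ∃ t ∈ T, s <+: t ∧ t ++ [false] ∈ T ∧ t ++ [true] ∈ T

/-- The initial segment `a↾n` of an infinite binary sequence. -/
def seg (a : ℕ → Bool) (n : ℕ) : List Bool := (List.range n).map a

/-- The initial segment `b↾n` of an element of Baire space. -/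
def segN (b : ℕ → ℕ) (n : ℕ) : List ℕ := (List.range n).map b

/-- The branch set `[T] = {a ∈ 2^ℕ : ∀ n, a↾n ∈ T}`. -/
def branches (T : Set (List Bool)) : Set (ℕ → Bool) := {a | ∀ n, seg a n ∈ T}

/-- The inclusion `ι : 2^ℕ → ℕ^ℕ` induced by `{0,1} ⊆ ℕ`. -/
def iota (a : ℕ → Bool) : ℕ → ℕ := fun n => (a n).toNat

/-- `r` is the root of `T`: the largest string with `T↾r = T`. -/
def IsRoot (T : Set (List Bool)) (r : List Bool) : Prop :=
  r ∈ T ∧ restr T r = T ∧ ∀ s ∈ T, restr T s = T → s <+: r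

/-- The root of a (perfect) tree, via choice. -/
noncomputable def root (T : Set (List Bool)) : List Bool :=
  Classical.epsilon fun r => IsRoot T r

/-- `T⇂i = T↾(roo(T)⌢i)`. -/
noncomputable def splitOne (T : Set (List Bool)) (i : Bool) : Set (List Bool) :=
  restr T (root T ++ [i])

/-- Iterated splitting `T⇂s`, with `T⇂Λ = T` and `T⇂(s⌢i) = (T⇂s)⇂i`. -/
noncomputable def splitAt (T : Set (List Bool)) (s : List Bool) : Set (List Bool) :=
  s.foldl splitOne T

/-- A splitting system: perfect trees `T_s` with `T_{s⌢i} ⊆ T_s⇂i`. -/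
def IsSplittingSystem (Tf : List Bool → Set (List Bool)) : Prop :=
  (∀ s, IsPerfect (Tf s)) ∧ ∀ (s : List Bool) (i : Bool), Tf (s ++ [i]) ⊆ splitOne (Tf s) i

/-- `S` is clopen in `T`: `S = ⋃_{s∈A} T↾s` for some finite `A ⊆ T`. -/
def ClopenIn (S T : Set (List Bool)) : Prop :=
  ∃ A : Set (List Bool), A.Finite ∧ A ⊆ T ∧ S = ⋃ s ∈ A, restr T s

/-- Functional perfect trees: codes for continuous functions `2^ℕ → ℕ^ℕ`. -/
def IsFPT (c : Set (List Bool × List ℕ)) : Prop :=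
  (∀ p ∈ c, p.1.length = p.2.length) ∧
  (∀ p ∈ c, ∀ n ≤ p.1.length, (p.1.take n, p.2.take n) ∈ c) ∧
  (∀ s : List Bool, ∃ u : List ℕ, (s, u) ∈ c) ∧
  (∀ p ∈ c, ∀ i : Bool, ∃ k : ℕ, (p.1 ++ [i], p.2 ++ [k]) ∈ c) ∧
  (∀ m : ℕ, ∃ k, m ≤ k ∧ ∀ s : List Bool, s.length = k →
      ∃ us : List ℕ, us.length = m ∧ ∀ u : List ℕ, (s, u) ∈ c → us <+: u)

/-- The code `cod(F) = {(a↾n, F(a)↾n) : a ∈ 2^ℕ, n ∈ ℕ}` of a function `F`. -/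
def cod (F : (ℕ → Bool) → ℕ → ℕ) : Set (List Bool × List ℕ) :=
  {p | ∃ (a : ℕ → Bool) (n : ℕ), p = (seg a n, segN (F a) n)}

/-- The relation `f_c` coded by `c`. -/
def fc (c : Set (List Bool × List ℕ)) : Set ((ℕ → Bool) × (ℕ → ℕ)) :=
  {q | ∀ m, (seg q.1 m, segN q.2 m) ∈ c}

theorem prefix_of_comparable_both {x y : List Bool}
    (h0 : x <+: y ++ [false] ∨ y ++ [false] <+: x)
    (h1 : x <+: y ++ [true] ∨ y ++ [true] <+: x) : x <+: y := by
  have key : ∀ i : Bool, (x <+: y ++ [i] ∨ y ++ [i] <+: x) → x <+: y ∨ y ++ [i] <+: x := by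
    rintro i (h | h)
    · rcases List.prefix_concat_iff.1 h with h | h
      · exact Or.inr (h ▸ List.prefix_rfl)
      · exact Or.inl h
    · exact Or.inr h
  rcases key _ h0 with h0 | h0
  · exact h0
  rcases key _ h1 with h1 | h1
  · exact h1
  exfalso
  have h2 := List.prefix_of_prefix_length_le h0 h1 (by simp)
  have h3 := h2.eq_of_length (by simp)
  simp at h3

theorem exists_concat_prefix {r u : List Bool} (h : r <+: u) (hne : u ≠ r) :
    ∃ j, r ++ [j] <+: u := by
  obtain ⟨v, rfl⟩ := h
  cases v with
  | nil => simp at hne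
  | cons j v => exact ⟨j, v, by simp⟩

theorem exists_isRoot {T : Set (List Bool)} (hT : IsPerfect T) : ∃ r, IsRoot T r := by
  classical
  obtain ⟨hTree, ⟨x, hx⟩, hP⟩ := hT
  obtain ⟨t, ht, -, h0, h1⟩ := hP x hx
  have hb : ∀ s, restr T s = T → s <+: t := by
    intro s hs
    refine prefix_of_comparable_both ?_ ?_
    · rw [← hs] at h0; exact h0.2
    · rw [← hs] at h1; exact h1.2
  let P : ℕ → Prop := fun n => ∃ s ∈ T, restr T s = T ∧ s.length = n
  have hP0 : P 0 := ⟨[], hTree List.nil_prefix hx, by simp [restr], rfl⟩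
  obtain ⟨r, hr, hrr, hrl⟩ := Nat.findGreatest_spec (P := P) (n := t.length) (Nat.zero_le _) hP0
  refine ⟨r, hr, hrr, fun s hs hss => ?_⟩
  have hle : s.length ≤ r.length := by
    rw [hrl]
    exact Nat.le_findGreatest (hb s hss).length_le ⟨s, hs, hss, rfl⟩
  exact List.prefix_of_prefix_length_le (hb s hss) (hb r hrr) hle

theorem root_isRoot {T : Set (List Bool)} (hT : IsPerfect T) : IsRoot T (root T) :=
  Classical.epsilon_spec (exists_isRoot hT)

theorem root_comparable {T : Set (List Bool)} (hT : IsPerfect T) {u : List Bool} (hu : u ∈ T) :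
    root T <+: u ∨ u <+: root T := by
  rw [← (root_isRoot hT).2.1] at hu
  exact hu.2

theorem root_concat_mem {T : Set (List Bool)} (hT : IsPerfect T) (i : Bool) :
    root T ++ [i] ∈ T := by
  by_contra hi
  obtain ⟨hr, hrr, hmax⟩ := root_isRoot hT
  have hcomp : ∀ u ∈ T, u ≠ root T → root T <+: u → root T ++ [!i] <+: u := by
    intro u hu hne hp
    obtain ⟨j, hj⟩ := exists_concat_prefix hp hne
    have hjT := hT.1 hj hu
    have : j = !i := by
      cases i <;> cases j <;> simp_all
    exact this ▸ hj
  obtain ⟨t, ht, hrt, h0, h1⟩ := hT.2.2 _ hr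
  have hmem : root T ++ [!i] ∈ T := by
    refine hT.1 (hcomp _ h0 ?_ (hrt.trans (List.prefix_append _ _))) h0
    intro he
    have := congrArg List.length he
    have := hrt.length_le
    simp at *
    omega
  have hres : restr T (root T ++ [!i]) = T := by
    refine Set.Subset.antisymm (fun u hu => hu.1) (fun u hu => ⟨hu, ?_⟩)
    rcases root_comparable hT hu with h | h
    · by_cases hne : u = root T
      · right; rw [hne]; exact List.prefix_append _ _
      · left; exact hcomp u hu hne h
    · right; exact h.trans (List.prefix_append _ _)
  have := (hmax _ hmem hres).length_le
  simp at this

theorem split_root_prefix {Tf : List Bool → Set (List Bool)} (h : IsSplittingSystem Tf)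
    (s : List Bool) (i : Bool) : root (Tf s) ++ [i] <+: root (Tf (s ++ [i])) := by
  refine prefix_of_comparable_both ?_ ?_
  · exact (h.2 s i (root_concat_mem (h.1 _) false)).2
  · exact (h.2 s i (root_concat_mem (h.1 _) true)).2

theorem split_append {Tf : List Bool → Set (List Bool)} (h : IsSplittingSystem Tf)
    (s v : List Bool) : Tf (s ++ v) ⊆ Tf s ∧ root (Tf s) <+: root (Tf (s ++ v)) ∧
      (root (Tf s)).length + v.length ≤ (root (Tf (s ++ v))).length := by
  induction v using List.reverseRecOn with
  | nil => simp
  | append_singleton v i ih =>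
    rw [← List.append_assoc]
    have hp := split_root_prefix h (s ++ v) i
    refine ⟨fun u hu => ih.1 (h.2 _ _ hu).1,
      ih.2.1.trans ((List.prefix_append _ _).trans hp), ?_⟩
    have := hp.length_le
    have := ih.2.2
    simp at *
    omega

theorem mem_fusion {X : Type} (F : List Bool → Set X) (u : X) :
    u ∈ (⋂ n : ℕ, ⋃ s ∈ {s : List Bool | s.length = n}, F s) ↔
      ∀ n, ∃ s : List Bool, s.length = n ∧ u ∈ F s := by
  simp

theorem root_mem_fusion {Tf : List Bool → Set (List Bool)} (h : IsSplittingSystem Tf)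
    (s : List Bool) (n : ℕ) : ∃ s' : List Bool, s'.length = n ∧ root (Tf s) ∈ Tf s' := by
  rcases le_total n s.length with hn | hn
  · refine ⟨s.take n, by simpa using hn, ?_⟩
    have := (split_append h (s.take n) (s.drop n)).1
    rw [List.take_append_drop] at this
    exact this (root_isRoot (h.1 s)).1
  · refine ⟨s ++ List.replicate (n - s.length) false, by simp; omega, ?_⟩
    exact (h.1 _).1 (split_append h s _).2.1 (root_isRoot (h.1 _)).1

theorem seg_prefix (a : ℕ → Bool) {m n : ℕ} (hmn : m ≤ n) : seg a m <+: seg a n := by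
  obtain ⟨k, rfl⟩ := Nat.exists_eq_add_of_le hmn
  simp [seg, List.range_add]

/-- The fusion of a splitting system is a perfect subtree of `T_Λ` whose branch set is
`⋂_n ⋃_{s∈2^n} [T_s]`. -/
theorem stmt_1 (Tf : List Bool → Set (List Bool)) (h : IsSplittingSystem Tf) :
    IsPerfect (⋂ n : ℕ, ⋃ s ∈ {s : List Bool | s.length = n}, Tf s) ∧
    (⋂ n : ℕ, ⋃ s ∈ {s : List Bool | s.length = n}, Tf s) ⊆ Tf [] ∧
    branches (⋂ n : ℕ, ⋃ s ∈ {s : List Bool | s.length = n}, Tf s) =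
      ⋂ n : ℕ, ⋃ s ∈ {s : List Bool | s.length = n}, branches (Tf s) := by
  have hTree : IsTree (⋂ n : ℕ, ⋃ s ∈ {s : List Bool | s.length = n}, Tf s) := by
    intro s t hst ht
    rw [mem_fusion] at ht ⊢
    intro n
    obtain ⟨w, hw, htw⟩ := ht n
    exact ⟨w, hw, (h.1 w).1 hst htw⟩
  have hroot : ∀ s, root (Tf s) ∈ (⋂ n : ℕ, ⋃ s ∈ {s : List Bool | s.length = n}, Tf s) :=
    fun s => (mem_fusion _ _).2 (root_mem_fusion h s)
  refine ⟨⟨hTree, ⟨_, hroot []⟩, ?_⟩, ?_, ?_⟩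
  · intro u hu
    obtain ⟨s, hs, hus⟩ := (mem_fusion _ _).1 hu u.length
    refine ⟨root (Tf s), hroot s, ?_, hTree (split_root_prefix h s false) (hroot _),
      hTree (split_root_prefix h s true) (hroot _)⟩
    rcases root_comparable (h.1 s) hus with hc | hc
    · have h1 := (split_append h [] s).2.2
      simp only [List.nil_append] at h1
      have := hc.length_le
      rw [hc.eq_of_length (by omega)]
    · exact hc
  · intro u hu
    obtain ⟨s, hs, hus⟩ := (mem_fusion _ _).1 hu 0
    rw [List.length_eq_zero_iff] at hs
    exact hs ▸ hus
  · ext a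
    rw [mem_fusion]
    constructor
    · intro ha n
      by_contra! hcon
      have hex : ∀ s : List Bool, ∃ m, s.length = n → seg a m ∉ Tf s := by
        intro s
        by_cases hs : s.length = n
        · have h2 := hcon s hs
          simp only [branches, Set.mem_setOf_eq, not_forall] at h2
          obtain ⟨m, hm⟩ := h2
          exact ⟨m, fun _ => hm⟩
        · exact ⟨0, fun h3 => absurd h3 hs⟩
      choose f hf using hex
      obtain ⟨M, hM⟩ := ((List.finite_length_eq Bool n).image f).bddAbove
      obtain ⟨s, hs, hus⟩ := (mem_fusion _ _).1 (ha M) n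
      exact hf s hs ((h.1 s).1 (seg_prefix a (hM ⟨s, hs, rfl⟩)) hus)
    · intro ha m
      rw [mem_fusion]
      intro n
      obtain ⟨s, hs, has⟩ := ha n
      exact ⟨s, hs, has m⟩
end

section
/- If c ∈ FPT, then f_c is the graph of a continuous function F : 2^ℕ → ℕ^ℕ (i.e. for every a ∈ 2^ℕ there is exactly one b ∈ ℕ^ℕ with (a,b) ∈ f_c, and the map a ↦ b is continuous), and moreover cod(F) = c. -/
open Set

lemma seg_len (a : ℕ → Bool) (n : ℕ) : (seg a n).length = n := by simp [seg]

lemma segN_len (b : ℕ → ℕ) (n : ℕ) : (segN b n).length = n := by simp [segN]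

lemma seg_succ (a : ℕ → Bool) (n : ℕ) : seg a (n + 1) = seg a n ++ [a n] := by
  simp [seg, List.range_succ]

lemma ext_branch (c : Set (List Bool × List ℕ)) (hc : IsFPT c) (a : ℕ → Bool) (n : ℕ)
    (u : List ℕ) (hu : (seg a n, u) ∈ c) : ∃ b, (a, b) ∈ fc c ∧ segN b n = u := by
  obtain ⟨h1, h2, h3, h4, h5⟩ := hc
  have hg : ∀ v : List ℕ, ∃ k : ℕ, (seg a v.length, v) ∈ c →
      (seg a (v.length + 1), v ++ [k]) ∈ c := by
    intro v
    by_cases hv : (seg a v.length, v) ∈ c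
    · obtain ⟨k, hk⟩ := h4 _ hv (a v.length)
      exact ⟨k, fun _ => by rw [seg_succ]; exact hk⟩
    · exact ⟨0, fun h => absurd h hv⟩
  choose g hg using hg
  have hlu : u.length = n := by
    have := h1 _ hu
    simp only [seg_len] at this
    exact this.symm
  let U : ℕ → List ℕ := fun j => Nat.rec u (fun _ v => v ++ [g v]) j
  have U0 : U 0 = u := rfl
  have US : ∀ j, U (j + 1) = U j ++ [g (U j)] := fun j => rfl
  have Ulen : ∀ j, (U j).length = n + j := by
    intro j
    induction j with
    | zero => simp [U0, hlu]
    | succ j ih => rw [US, List.length_append, ih]; simp; omega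
  have Uc : ∀ j, (seg a (n + j), U j) ∈ c := by
    intro j
    induction j with
    | zero => exact hu
    | succ j ih =>
      have := hg (U j)
      rw [Ulen] at this
      exact this ih
  have Upre : ∀ j l, U j <+: U (j + l) := by
    intro j l
    induction l with
    | zero => exact List.prefix_refl _
    | succ l ih => exact ih.trans ⟨_, (US (j + l)).symm⟩
  have Uget : ∀ j l i, i < n + j → i < n + l → (U j)[i]? = (U l)[i]? := by
    have key : ∀ j l i, i < n + j → (U (j + l))[i]? = (U j)[i]? := by
      intro j l i hi
      obtain ⟨w, hw⟩ := Upre j l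
      rw [← hw, List.getElem?_append_left (by rw [Ulen]; exact hi)]
    intro j l i hj hl
    rw [← key j l i hj, ← key l j i hl, Nat.add_comm]
  let b : ℕ → ℕ := fun i => ((U (i + 1))[i]?).getD 0
  have hb : ∀ j, segN b (n + j) = U j := by
    intro j
    apply List.ext_getElem
    · rw [segN_len, Ulen]
    · intro i hi hi'
      have hij : i < n + j := by rwa [segN_len] at hi
      have : (segN b (n + j))[i] = b i := by simp [segN]
      rw [this]
      change ((U (i + 1))[i]?).getD 0 = _
      rw [Uget (i + 1) j i (by omega) hij, List.getElem?_eq_getElem hi']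
      rfl
  refine ⟨b, ?_, hb 0⟩
  intro m
  have := h2 _ (Uc m) m (by simp [seg_len])
  rw [← hb m] at this
  have e1 : (seg a (n + m)).take m = seg a m := by
    simp [seg, ← List.map_take, List.take_range]
  have e2 : (segN b (n + m)).take m = segN b m := by
    simp [segN, ← List.map_take, List.take_range]
  simp only [e1, e2] at this
  exact this

lemma fc_det (c : Set (List Bool × List ℕ)) (hc : IsFPT c) (m : ℕ) :
    ∃ k, ∀ a a' b b', (a, b) ∈ fc c → (a', b') ∈ fc c → seg a k = seg a' k → b m = b' m := by
  obtain ⟨h1, h2, h3, h4, h5⟩ := hc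
  obtain ⟨k, hmk, hk⟩ := h5 (m + 1)
  refine ⟨k, ?_⟩
  intro a a' b b' hb hb' e
  obtain ⟨us, hus, hp⟩ := hk (seg a k) (seg_len a k)
  obtain ⟨w, hw⟩ := hp _ (hb k)
  obtain ⟨w', hw'⟩ := hp _ (by rw [e]; exact hb' k)
  have g1 : (segN b k)[m]? = some (b m) := by
    simp [segN, List.getElem?_range (show m < k by omega)]
  have g2 : (segN b' k)[m]? = some (b' m) := by
    simp [segN, List.getElem?_range (show m < k by omega)]
  dsimp only at hw hw'
  rw [← hw, List.getElem?_append_left (by omega)] at g1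
  rw [← hw', List.getElem?_append_left (by omega)] at g2
  rw [g1] at g2
  exact Option.some.inj g2

/-- If `c ∈ FPT`, then `f_c` is the graph of a continuous function `F : 2^ℕ → ℕ^ℕ`,
and `cod(F) = c`. -/
theorem stmt_10 (c : Set (List Bool × List ℕ)) (hc : IsFPT c) :
    ∃ F : (ℕ → Bool) → ℕ → ℕ, Continuous F ∧
      (∀ (a : ℕ → Bool) (b : ℕ → ℕ), ((a, b) ∈ fc c ↔ b = F a)) ∧ cod F = c := by
  have hex : ∀ a, ∃ b, (a, b) ∈ fc c := by
    intro a
    obtain ⟨u, hu⟩ := hc.2.2.1 (seg a 0)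
    obtain ⟨b, hb, _⟩ := ext_branch c hc a 0 u hu
    exact ⟨b, hb⟩
  choose F hF using hex
  have huniq : ∀ a b, (a, b) ∈ fc c → b = F a := by
    intro a b hb
    funext m
    obtain ⟨k, hk⟩ := fc_det c hc m
    exact hk a a b (F a) hb (hF a) rfl
  refine ⟨F, ?_, ?_, ?_⟩
  · refine continuous_pi fun m => ?_
    obtain ⟨k, hk⟩ := fc_det c hc m
    rw [← IsLocallyConstant.iff_continuous, IsLocallyConstant.iff_exists_open]
    intro a
    refine ⟨{a' | ∀ i ∈ Finset.range k, a' i = a i}, ?_, fun _ _ => rfl, ?_⟩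
    · have : {a' : ℕ → Bool | ∀ i ∈ Finset.range k, a' i = a i}
          = Set.pi (Finset.range k : Set ℕ) (fun i => {a i}) := by
        ext x; simp [Set.mem_pi]
      rw [this]
      exact isOpen_set_pi (Finset.finite_toSet _) (fun _ _ => isOpen_discrete _)
    · intro a' ha'
      refine hk a' a _ _ (hF a') (hF a) ?_
      apply List.map_congr_left
      intro i hi
      exact ha' i (by simpa using hi)
  · intro a b
    exact ⟨huniq a b, fun h => h ▸ hF a⟩
  · ext ⟨s, u⟩
    constructor
    · rintro ⟨a, n, h⟩
      rw [h]
      exact hF a n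
    · intro h
      have hs : seg (fun i => s.getD i false) s.length = s := by
        apply List.ext_getElem
        · rw [seg_len]
        · intro i hi hi'
          simp [seg, hi']
      obtain ⟨b, hb, hbu⟩ := ext_branch c hc (fun i => s.getD i false) s.length u
        (by rw [hs]; exact h)
      refine ⟨fun i => s.getD i false, s.length, ?_⟩
      rw [hs, ← huniq _ b hb, hbu]
end

section
/- Let λ be an ordinal and (J_α)_{α<λ} a family of sets of perfect trees such that: (i) each J_α is closed under passing to perfect subtrees clopen in a member; (ii) for every α < λ and every S ∈ J_{<α} := ⋃_{γ<α} J_γ there is T ∈ J_α with T ⊆ S; (iii) for all β < α < λ and every T ∈ J_α there is a finite set A of perfect trees, each a subtree of some member of J_β, with pairwise disjoint branch sets and [T] ⊆ ⋃_{S∈A} [S]. Then for every β < λ, J_β is pre-dense in J_{<λ} = ⋃_{α<λ} J_α: for every T ∈ J_{<λ} there are T' ∈ J_{<λ} and S ∈ J_β with T' ⊆ T and T' ⊆ S. -/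
open Set

theorem exists_branch {T : Set (List Bool)} (hT : IsPerfect T) {t : List Bool} (ht : t ∈ T) :
    ∃ a ∈ branches T, seg a t.length = t := by
  obtain ⟨h1, -, h3⟩ := hT
  have hstep : ∀ s : T, ∃ s' : T, s.1 <+: s'.1 ∧ s.1.length < s'.1.length := by
    rintro ⟨s, hs⟩
    obtain ⟨u, hu, hsu, hu0, -⟩ := h3 s hs
    refine ⟨⟨_, hu0⟩, hsu.trans (List.prefix_append _ _), ?_⟩
    have := hsu.length_le
    simp
    omega
  choose g hg hgl using hstep
  let u : ℕ → T := fun n => g^[n] ⟨t, ht⟩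
  have hu : ∀ n, u (n + 1) = g (u n) := fun n => Function.iterate_succ_apply' g n _
  have hlen : ∀ n, n ≤ (u n).1.length := by
    intro n
    induction n with
    | zero => simp
    | succ n ih =>
      have := hgl (u n)
      rw [hu]
      omega
  have hmono : ∀ m n, m ≤ n → (u m).1 <+: (u n).1 := by
    intro m n hmn
    induction n, hmn using Nat.le_induction with
    | base => exact List.prefix_rfl
    | succ n _ ih =>
      rw [hu]
      exact ih.trans (hg _)
  let a : ℕ → Bool := fun n => (u (n + 1)).1.getD n false
  have hseg : ∀ n, seg a n = (u n).1.take n := by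
    intro n
    apply List.ext_getElem
    · simp [seg, hlen n]
    · intro i hi hi'
      have hin : i < n := by simpa [seg] using hi
      have hi1 : i < (u (i + 1)).1.length := hlen (i + 1)
      have := (hmono (i + 1) n hin).getElem hi1
      simp [seg, a, List.getElem?_eq_getElem hi1, this]
  refine ⟨a, fun n => ?_, ?_⟩
  · rw [hseg]
    exact h1 (List.take_prefix _ _) (u n).2
  · rw [hseg]
    exact (List.prefix_iff_eq_take.mp (hmono 0 t.length (Nat.zero_le _))).symm

theorem restr_perfect {T : Set (List Bool)} (hT : IsPerfect T) {s : List Bool} (hs : s ∈ T) :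
    IsPerfect (restr T s) := by
  obtain ⟨h1, -, h3⟩ := hT
  refine ⟨?_, ⟨s, hs, Or.inl List.prefix_rfl⟩, ?_⟩
  · rintro x y hxy ⟨hy, h⟩
    refine ⟨h1 hxy hy, ?_⟩
    rcases h with h | h
    · exact List.prefix_or_prefix_of_prefix h hxy
    · exact Or.inr (hxy.trans h)
  · have key : ∀ x ∈ T, s <+: x → ∃ t ∈ restr T s, x <+: t ∧ t ++ [false] ∈ restr T s ∧
        t ++ [true] ∈ restr T s := by
      intro x hx hsx
      obtain ⟨t, ht, hxt, h0, h1⟩ := h3 x hx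
      have hst := hsx.trans hxt
      exact ⟨t, ⟨ht, Or.inl hst⟩, hxt, ⟨h0, Or.inl (hst.trans (List.prefix_append _ _))⟩,
        ⟨h1, Or.inl (hst.trans (List.prefix_append _ _))⟩⟩
    rintro x ⟨hx, h | h⟩
    · exact key x hx h
    · obtain ⟨t, ht, hst, h⟩ := key s hs List.prefix_rfl
      exact ⟨t, ht, ‹x <+: s›.trans hst, h⟩

theorem exists_avoid {T : Set (List Bool)} (hT : IsPerfect T) {A : Set (Set (List Bool))}
    (hA : A.Finite) (hAt : ∀ S ∈ A, IsTree S)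
    (hno : ∀ S ∈ A, ∀ s ∈ T, ¬ restr T s ⊆ S) : ∃ t ∈ T, ∀ S ∈ A, t ∉ S := by
  induction A, hA using Set.Finite.induction_on with
  | empty =>
    obtain ⟨t, ht⟩ := hT.2.1
    exact ⟨t, ht, by simp⟩
  | @insert S A _ _ ih =>
    obtain ⟨t, ht, hA⟩ := ih (fun S hS => hAt S (Or.inr hS)) (fun S hS => hno S (Or.inr hS))
    obtain ⟨x, ⟨hx, h⟩, hxS⟩ := Set.not_subset.mp (hno S (Or.inl rfl) t ht)
    rcases h with h | h
    · refine ⟨x, hx, ?_⟩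
      rintro S' (rfl | hS')
      · exact hxS
      · exact fun hh => hA S' hS' (hAt S' (Or.inr hS') h hh)
    · refine ⟨t, ht, ?_⟩
      rintro S' (rfl | hS')
      · exact fun hh => hxS (hAt S' (Or.inl rfl) h hh)
      · exact hA S' hS'

/-- Pre-density in Jensen-type sequences: under conditions (i)–(iii), each level `J_β`
is pre-dense in `J_{<λ}`. -/
theorem stmt_15 (lam : Ordinal) (J : Ordinal → Set (Set (List Bool)))
    (hperf : ∀ α < lam, ∀ T ∈ J α, IsPerfect T)
    (hclopen : ∀ α < lam, ∀ T ∈ J α,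
      ∀ S : Set (List Bool), IsPerfect S → ClopenIn S T → S ∈ J α)
    (hdense : ∀ α < lam, ∀ S ∈ {S | ∃ γ < α, S ∈ J γ}, ∃ T ∈ J α, T ⊆ S)
    (hiii : ∀ β α, β < α → α < lam → ∀ T ∈ J α,
      ∃ A : Set (Set (List Bool)), A.Finite ∧
        (∀ S ∈ A, IsPerfect S ∧ ∃ S' ∈ J β, S ⊆ S') ∧
        (∀ S ∈ A, ∀ S' ∈ A, S ≠ S' → branches S ∩ branches S' = ∅) ∧
        branches T ⊆ ⋃ S ∈ A, branches S) :
    ∀ β < lam, ∀ T ∈ {S | ∃ α < lam, S ∈ J α},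
      ∃ T' ∈ {S | ∃ α < lam, S ∈ J α}, ∃ S ∈ J β, T' ⊆ T ∧ T' ⊆ S := by
  rintro β hβ T ⟨α, hα, hT⟩
  rcases lt_trichotomy α β with h | rfl | h
  · obtain ⟨T', hT', hs⟩ := hdense β hβ T ⟨α, h, hT⟩
    exact ⟨T', ⟨β, hβ, hT'⟩, T', hT', hs, subset_rfl⟩
  · exact ⟨T, ⟨α, hα, hT⟩, T, hT, subset_rfl, subset_rfl⟩
  · have hTp := hperf α hα T hT
    obtain ⟨A, hAf, hA, -, hcov⟩ := hiii β α h hα T hT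
    have : ∃ S ∈ A, ∃ s ∈ T, restr T s ⊆ S := by
      by_contra hcon
      push Not at hcon
      obtain ⟨t, ht, htA⟩ := exists_avoid hTp hAf (fun S hS => (hA S hS).1.1) hcon
      obtain ⟨a, ha, hat⟩ := exists_branch hTp ht
      have := hcov ha
      simp only [Set.mem_iUnion] at this
      obtain ⟨S, hS, haS⟩ := this
      exact htA S hS (hat ▸ haS t.length)
    obtain ⟨S, hS, s, hs, hsub⟩ := this
    obtain ⟨-, S', hS', hSS'⟩ := hA S hS
    refine ⟨restr T s, ⟨α, hα, hclopen α hα T hT _ (restr_perfect hTp hs)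
      ⟨{s}, Set.finite_singleton s, by simpa using hs, by simp⟩⟩, S', hS', fun x hx => hx.1,
      hsub.trans hSS'⟩
end
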